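/- Let X be a sub-Gaussian random vector in ℝ^d whose function A(h) = |h|²/2 − K(h), K(h) = log E exp(⟨h,X⟩), satisfies A(h) ≥ 0 for all h. Then every eigenvalue λ of the covariance matrix K''(h) (Hessian of K at h) satisfies λ ≤ 8 A(h) + 2 log 2; equivalently, ⟨K''(h)θ, θ⟩ ≤ 8 A(h) + 2 log 2 for every unit vector θ ∈ ℝ^d and every h ∈ ℝ^d. -/

import Mathlib

open MeasureTheory ProbabilityTheory Real Filter
open scoped ENNReal RealInnerProductSpace Topology

/-- A probability distribution on `ℝ^d` is sub-Gaussian if `E exp(c|X|²) < ∞` for some `c > 0`. -/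
def IsSubGaussian {d : ℕ} (μ : Measure (EuclideanSpace ℝ (Fin d))) : Prop :=
  ∃ c > 0, Integrable (fun x => Real.exp (c * ‖x‖ ^ 2)) μ

/-- The log-Laplace transform `K(t) = log ∫ e^{⟨t,x⟩} dμ(x)`. -/
noncomputable def Kfun {d : ℕ} (μ : Measure (EuclideanSpace ℝ (Fin d)))
    (t : EuclideanSpace ℝ (Fin d)) : ℝ :=
  Real.log (∫ x, Real.exp ⟪t, x⟫ ∂μ)

/-- The function `A(t) = |t|²/2 - K(t)`. -/
noncomputable def Afun {d : ℕ} (μ : Measure (EuclideanSpace ℝ (Fin d)))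
    (t : EuclideanSpace ℝ (Fin d)) : ℝ :=
  ‖t‖ ^ 2 / 2 - Kfun μ t

lemma pow_add_mul_sub_le_pow {u v : ℝ} (hu : 0 ≤ u) (hv : 0 ≤ v) (n : ℕ) :
    v ^ (n + 1) + (n + 1) * v ^ n * (u - v) ≤ u ^ (n + 1) := by
  induction n with
  | zero => simp
  | succ n ih =>
    have h₁ := mul_le_mul_of_nonneg_left ih hu
    have h₂ : 0 ≤ (n + 1) * v ^ n * (u - v) ^ 2 := by positivity
    push_cast
    ring_nf at h₁ h₂ ⊢
    linarith

/-- The tangent line inequality for the convex function `u ↦ cosh √u`. -/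
lemma sq_sub_sq_mul_sinh_le (y : ℝ) {t : ℝ} (ht : 0 ≤ t) :
    (y ^ 2 - t ^ 2) * sinh t ≤ 2 * t * (cosh y - cosh t) := by
  have hcosh (x : ℝ) : HasSum (fun n : ℕ => x ^ (2 * (n + 1)) / (2 * (n + 1)).factorial)
      (cosh x - 1) := by
    simpa using (hasSum_nat_add_iff' 1).mpr (Real.hasSum_cosh x)
  have hdiff := ((hcosh y).sub (hcosh t)).mul_left (2 * t)
  rw [sub_sub_sub_cancel_right] at hdiff
  refine hasSum_le (fun n => ?_) ((Real.hasSum_sinh t).mul_left (y ^ 2 - t ^ 2)) hdiff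
  have hpow := pow_add_mul_sub_le_pow (sq_nonneg y) (sq_nonneg t) n
  have hfac : ((2 * (n + 1)).factorial : ℝ) = 2 * (n + 1) * (2 * n + 1).factorial := by
    rw [show 2 * (n + 1) = (2 * n + 1) + 1 by ring, Nat.factorial_succ]
    push_cast
    ring
  have hpos : (0 : ℝ) < (2 * n + 1).factorial := by positivity
  rw [hfac, ← sub_div, mul_div_assoc', mul_div_assoc', div_le_div_iff₀ hpos (by positivity)]
  have h := mul_le_mul_of_nonneg_left hpow
    (show 0 ≤ 2 * t * ((2 * n + 1).factorial : ℝ) by positivity)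
  simp only [← pow_mul] at h
  have e : t ^ (2 * n + 1) = t * t ^ (2 * n) := by ring
  rw [e]
  linarith

lemma integral_sq_le_of_mgf_le {Ω : Type*} [MeasurableSpace Ω] {ν : Measure Ω}
    [IsProbabilityMeasure ν] {Z : Ω → ℝ} {a : ℝ}
    (hsq : Integrable (fun ω => Z ω ^ 2) ν) (hexp : ∀ r, Integrable (fun ω => exp (r * Z ω)) ν)
    (hmgf : ∀ r, mgf Z ν r ≤ exp (a + r ^ 2 / 2)) :
    ∫ ω, Z ω ^ 2 ∂ν ≤ 2 * a + 2 * log 2 := by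
  have ha : 0 ≤ a := by simpa using hmgf 0
  have hlog : 0 ≤ log 2 := log_nonneg one_le_two
  set m := ∫ ω, Z ω ^ 2 ∂ν with hm
  have hm0 : 0 ≤ m := integral_nonneg fun ω => sq_nonneg _
  rcases hm0.eq_or_lt with h0 | hmpos
  · linarith
  have hs : √m ^ 2 = m := sq_sqrt hm0
  have hcosh_eq : (fun ω => cosh (√m * Z ω)) =
      fun ω => (exp (√m * Z ω) + exp (-√m * Z ω)) / 2 := by
    ext ω
    rw [cosh_eq, neg_mul]
  have hcosh_int : Integrable (fun ω => cosh (√m * Z ω)) ν := by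
    rw [hcosh_eq]
    exact ((hexp _).add (hexp _)).div_const 2
  have hupper : ∫ ω, cosh (√m * Z ω) ∂ν ≤ exp (a + m / 2) := by
    have h₁ := hmgf (√m)
    have h₂ := hmgf (-√m)
    rw [neg_sq] at h₂
    rw [hs] at h₁ h₂
    rw [hcosh_eq, integral_div, integral_add (hexp _) (hexp _)]
    simp only [mgf] at h₁ h₂
    linarith
  have hlower : cosh m ≤ ∫ ω, cosh (√m * Z ω) ∂ν := by
    have h := integral_mono (μ := ν)
      (f := fun ω => (m * Z ω ^ 2 - m ^ 2) * sinh m)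
      (g := fun ω => 2 * m * (cosh (√m * Z ω) - cosh m))
      (((hsq.const_mul m).sub (integrable_const _)).mul_const _)
      ((hcosh_int.sub (integrable_const _)).const_mul _)
      (fun ω => by
        have := sq_sub_sq_mul_sinh_le (√m * Z ω) hm0
        rwa [mul_pow, hs] at this)
    rw [integral_mul_const, integral_const_mul, integral_sub (hsq.const_mul m) (integrable_const _),
      integral_sub hcosh_int (integrable_const _), integral_const_mul, ← hm] at h
    simp only [integral_const, probReal_univ, one_smul] at h
    rw [← pow_two, sub_self, zero_mul] at h
    have := nonneg_of_mul_nonneg_right h (by positivity)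
    linarith
  have hexp_le : exp (m - log 2) ≤ exp (a + m / 2) := by
    refine le_trans ?_ (hlower.trans hupper)
    rw [exp_sub, exp_log two_pos, cosh_eq]
    have := exp_pos (-m)
    linarith
  have := exp_le_exp.mp hexp_le
  linarith

section LaplaceTransform

variable {d : ℕ} {μ : Measure (EuclideanSpace ℝ (Fin d))}

lemma IsSubGaussian.integrable_exp_mul_norm (hsub : IsSubGaussian μ) (a : ℝ) :
    Integrable (fun x => exp (a * ‖x‖)) μ := by
  obtain ⟨c, hc, hint⟩ := hsub
  refine (hint.const_mul (exp (a ^ 2 / (4 * c)))).mono' (by fun_prop) (ae_of_all _ fun x => ?_)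
  rw [norm_of_nonneg (exp_pos _).le, ← exp_add, exp_le_exp]
  have h : 0 ≤ (2 * c * ‖x‖ - a) ^ 2 / (4 * c) := by positivity
  have e : (2 * c * ‖x‖ - a) ^ 2 / (4 * c) = c * ‖x‖ ^ 2 - a * ‖x‖ + a ^ 2 / (4 * c) := by
    field_simp
    ring
  linarith

lemma IsSubGaussian.integrable_exp_inner (hsub : IsSubGaussian μ)
    (t : EuclideanSpace ℝ (Fin d)) : Integrable (fun x => exp ⟪t, x⟫) μ := by
  refine (hsub.integrable_exp_mul_norm ‖t‖).mono' (by fun_prop) (ae_of_all _ fun x => ?_)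
  rw [norm_of_nonneg (exp_pos _).le, exp_le_exp]
  exact real_inner_le_norm t x

variable [IsProbabilityMeasure μ]

lemma IsSubGaussian.differentiable_Kfun (hsub : IsSubGaussian μ) :
    Differentiable ℝ (Kfun μ) := by
  intro t₀
  have hint := hasFDerivAt_integral_of_dominated_of_fderiv_le (𝕜 := ℝ) (μ := μ)
    (F := fun t x => exp ⟪t, x⟫) (F' := fun t x => exp ⟪t, x⟫ • innerSL ℝ x) (x₀ := t₀)
    (bound := fun x => exp ((‖t₀‖ + 2) * ‖x‖)) (Metric.ball_mem_nhds t₀ one_pos)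
    (Eventually.of_forall fun t => (hsub.integrable_exp_inner t).aestronglyMeasurable)
    (hsub.integrable_exp_inner t₀) (by fun_prop)
    (ae_of_all _ fun x t ht => ?_) (hsub.integrable_exp_mul_norm _)
    (ae_of_all _ fun x t _ => ?_)
  · exact hint.differentiableAt.log (integral_exp_pos (hsub.integrable_exp_inner t₀)).ne'
  · have ht' : ‖t‖ ≤ ‖t₀‖ + 1 := by
      have h := norm_le_norm_add_norm_sub' t t₀
      rw [Metric.mem_ball, dist_eq_norm] at ht
      linarith
    rw [norm_smul, norm_of_nonneg (exp_pos _).le, innerSL_apply_norm]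
    have hle : ⟪t, x⟫ ≤ (‖t₀‖ + 1) * ‖x‖ :=
      (real_inner_le_norm t x).trans (by gcongr)
    calc exp ⟪t, x⟫ * ‖x‖ ≤ exp ((‖t₀‖ + 1) * ‖x‖) * exp ‖x‖ := by
          gcongr
          linarith [add_one_le_exp ‖x‖]
      _ = exp ((‖t₀‖ + 2) * ‖x‖) := by
          rw [← exp_add]
          ring_nf
  · have h : HasFDerivAt (fun t => ⟪t, x⟫) (innerSL ℝ x) t := by
      have h' := (innerSL ℝ x).hasFDerivAt (x := t)
      simpa only [innerSL_apply_apply, real_inner_comm] using! h'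
    exact h.exp

lemma exp_Kfun (hsub : IsSubGaussian μ) (t : EuclideanSpace ℝ (Fin d)) :
    exp (Kfun μ t) = ∫ x, exp ⟪t, x⟫ ∂μ :=
  exp_log (integral_exp_pos (hsub.integrable_exp_inner t))

lemma mgf_inner_tilted (hsub : IsSubGaussian μ) (h θ : EuclideanSpace ℝ (Fin d)) (r : ℝ) :
    mgf (fun x => ⟪θ, x⟫) (μ.tilted fun x => ⟪h, x⟫) r =
      exp (Kfun μ (h + r • θ) - Kfun μ h) := by
  rw [mgf, integral_exp_tilted, exp_sub, exp_Kfun hsub, exp_Kfun hsub]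
  simp only [Pi.add_apply, inner_add_left, real_inner_smul_left]

lemma integrable_exp_mul_inner_tilted (hsub : IsSubGaussian μ)
    (h θ : EuclideanSpace ℝ (Fin d)) (r : ℝ) :
    Integrable (fun x => exp (r * ⟪θ, x⟫)) (μ.tilted fun x => ⟪h, x⟫) := by
  have := isProbabilityMeasure_tilted (hsub.integrable_exp_inner h)
  refine Integrable.of_integral_ne_zero ?_
  have h' := mgf_inner_tilted hsub h θ r
  rw [mgf] at h'
  rw [h']
  exact (exp_pos _).ne'

lemma integrableExpSet_inner_tilted (hsub : IsSubGaussian μ)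
    (h θ : EuclideanSpace ℝ (Fin d)) :
    integrableExpSet (fun x => ⟪θ, x⟫) (μ.tilted fun x => ⟪h, x⟫) = Set.univ :=
  Set.eq_univ_of_forall fun r => integrable_exp_mul_inner_tilted hsub h θ r

lemma cgf_inner_tilted (hsub : IsSubGaussian μ) (h θ : EuclideanSpace ℝ (Fin d)) :
    cgf (fun x => ⟪θ, x⟫) (μ.tilted fun x => ⟪h, x⟫) =
      fun r => Kfun μ (h + r • θ) - Kfun μ h := by
  ext r
  rw [cgf, mgf_inner_tilted hsub, log_exp]

lemma variance_inner_tilted_le (hsub : IsSubGaussian μ) (hA : ∀ h, 0 ≤ Afun μ h)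
    (h θ : EuclideanSpace ℝ (Fin d)) (hθ : ‖θ‖ = 1) :
    Var[fun x => ⟪θ, x⟫; μ.tilted fun x => ⟪h, x⟫] ≤ 2 * Afun μ h + 2 * log 2 := by
  have := isProbabilityMeasure_tilted (hsub.integrable_exp_inner h)
  set ν := μ.tilted fun x => ⟪h, x⟫ with hν
  have hexp (r : ℝ) : (fun x => exp (r * (⟪θ, x⟫ - ⟪h, θ⟫))) =
      fun x => exp (r * ⟪θ, x⟫) * exp (-(r * ⟪h, θ⟫)) := by
    ext x
    rw [← exp_add]
    ring_nf
  have hmem : MemLp (fun x => ⟪θ, x⟫) 2 ν :=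
    memLp_of_mem_interior_integrableExpSet
      (by rw [hν, integrableExpSet_inner_tilted hsub, interior_univ]; trivial) 2
  have hmem' : MemLp (fun x => ⟪θ, x⟫ - ⟪h, θ⟫) 2 ν := hmem.sub (memLp_const _)
  rw [← variance_sub_const hmem.aestronglyMeasurable ⟪h, θ⟫]
  refine (variance_le_expectation_sq hmem'.aestronglyMeasurable).trans ?_
  refine integral_sq_le_of_mgf_le hmem'.integrable_sq (fun r => ?_) (fun r => ?_)
  · rw [hexp]
    exact (integrable_exp_mul_inner_tilted hsub h θ r).mul_const _
  · have hm := mgf_inner_tilted hsub h θ r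
    rw [mgf] at hm
    rw [mgf, hexp, integral_mul_const, hm, ← exp_add, exp_le_exp]
    have hK := hA (h + r • θ)
    simp only [Afun] at hK ⊢
    rw [norm_add_sq_real, real_inner_smul_right, norm_smul, hθ, mul_one, norm_eq_abs, sq_abs] at hK
    linarith

lemma fderiv_fderiv_Kfun_apply (hsub : IsSubGaussian μ) {h : EuclideanSpace ℝ (Fin d)}
    (hdiff : DifferentiableAt ℝ (fderiv ℝ (Kfun μ)) h) (θ : EuclideanSpace ℝ (Fin d)) :
    fderiv ℝ (fderiv ℝ (Kfun μ)) h θ θ =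
      Var[fun x => ⟪θ, x⟫; μ.tilted fun x => ⟪h, x⟫] := by
  have := isProbabilityMeasure_tilted (hsub.integrable_exp_inner h)
  have hline (r : ℝ) : HasDerivAt (fun r : ℝ => h + r • θ) θ r := by
    simpa using ((hasDerivAt_id r).smul_const θ).const_add h
  have hvar := variance_tilted_mul (X := fun x => ⟪θ, x⟫) (μ := μ.tilted fun x => ⟪h, x⟫)
    (t := 0) (by rw [integrableExpSet_inner_tilted hsub, interior_univ]; trivial)
  simp only [zero_mul, tilted_const] at hvar
  have hfirst : deriv (fun r : ℝ => Kfun μ (h + r • θ) - Kfun μ h) =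
      fun r => fderiv ℝ (Kfun μ) (h + r • θ) θ := by
    ext r
    exact (((hsub.differentiable_Kfun _).hasFDerivAt.comp_hasDerivAt r (hline r)).sub_const _).deriv
  rw [hvar, cgf_inner_tilted hsub, iteratedDeriv_succ, iteratedDeriv_one, hfirst]
  have hsecond : HasFDerivAt (fderiv ℝ (Kfun μ)) (fderiv ℝ (fderiv ℝ (Kfun μ)) h)
      (h + (0 : ℝ) • θ) := by
    simpa using hdiff.hasFDerivAt
  have hcomp := hsecond.comp_hasDerivAt (0 : ℝ) (hline 0)
  have happ := hcomp.clm_apply (hasDerivAt_const (0 : ℝ) θ)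
  simpa using happ.deriv.symm

end LaplaceTransform

theorem stmt10 {d : ℕ} (hd : 1 ≤ d)
    (μ : Measure (EuclideanSpace ℝ (Fin d))) [IsProbabilityMeasure μ]
    (hsub : IsSubGaussian μ)
    (hA : ∀ h, 0 ≤ Afun μ h)
    (h θ : EuclideanSpace ℝ (Fin d)) (hθ : ‖θ‖ = 1) :
    iteratedFDeriv ℝ 2 (Kfun μ) h ![θ, θ] ≤ 8 * Afun μ h + 2 * Real.log 2 := by
  have hAh := hA h
  have hlog : 0 ≤ log 2 := log_nonneg one_le_two
  rw [iteratedFDeriv_two_apply]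
  simp only [Matrix.cons_val_zero, Matrix.cons_val_one]
  by_cases hdiff : DifferentiableAt ℝ (fderiv ℝ (Kfun μ)) h
  · rw [fderiv_fderiv_Kfun_apply hsub hdiff]
    linarith [variance_inner_tilted_le hsub hA h θ hθ]
  · rw [fderiv_zero_of_not_differentiableAt hdiff]
    simp only [zero_apply]
    linarith
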